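/- A finite simple connected graph G induces a 5-periodic Grover walk if and only if G is isomorphic to the cycle graph C_5. -/

import Mathlib

open Matrix SimpleGraph

/-- The Grover transfer matrix `U = U(G)` of a finite simple graph `G`, a `2m × 2m`
complex matrix indexed by the darts (symmetric arcs) of `G`.  For darts `e, f`,
`U e f = 2/deg(t(f)) - 1` if `f = e⁻¹`, `U e f = 2/deg(t(f))` if `t(f) = o(e)` and
`f ≠ e⁻¹`, and `U e f = 0` otherwise. -/
noncomputable def groverMatrix {V : Type*} [Fintype V] [DecidableEq V]
    (G : SimpleGraph V) [DecidableRel G.Adj] : Matrix G.Dart G.Dart ℂ :=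
  fun e f =>
    if f = e.symm then 2 / (G.degree f.snd : ℂ) - 1
    else if f.snd = e.fst then 2 / (G.degree f.snd : ℂ)
    else 0

/-- `G` induces a `k`-periodic Grover walk: `U ^ k = 1` and `U ^ j ≠ 1` for `1 ≤ j < k`. -/
def InducesPeriodicGroverWalk {V : Type*} [Fintype V] [DecidableEq V]
    (G : SimpleGraph V) [DecidableRel G.Adj] (k : ℕ) : Prop :=
  groverMatrix G ^ k = 1 ∧ ∀ j : ℕ, 1 ≤ j → j < k → groverMatrix G ^ j ≠ 1

/-- The transition matrix of the isotropic random walk on `G`: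
`T u v = 1/deg(u)` if `u ∼ v` and `0` otherwise. -/
noncomputable def transitionMatrix {V : Type*} [Fintype V]
    (G : SimpleGraph V) [DecidableRel G.Adj] : Matrix V V ℝ :=
  fun u v => if G.Adj u v then 1 / (G.degree u : ℝ) else 0

namespace GroverAux

variable {V : Type*} [Fintype V] [DecidableEq V] (G : SimpleGraph V) [DecidableRel G.Adj]

lemma card_snd_fiber (u : V) :
    ((Finset.univ : Finset G.Dart).filter (fun f => f.snd = u)).card = G.degree u := by
  rw [← G.dart_fst_fiber_card_eq_degree u]
  apply Finset.card_bij (fun f _ => f.symm)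
  · intro a ha
    simpa using ha
  · intro a _ b _ h
    exact SimpleGraph.Dart.symm_involutive.injective h
  · intro b hb
    refine ⟨b.symm, ?_, by simp⟩
    simpa using hb

lemma mulVec_grover (ψ : G.Dart → ℂ) (e : G.Dart) :
    (groverMatrix G *ᵥ ψ) e =
      2 / (G.degree e.fst : ℂ) * (∑ f with f.snd = e.fst, ψ f) - ψ e.symm := by
  have h : ∀ f, groverMatrix G e f * ψ f =
      (if f.snd = e.fst then 2 / (G.degree e.fst : ℂ) * ψ f else 0)
        - (if f = e.symm then ψ f else 0) := by
    intro f
    unfold groverMatrix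
    by_cases h1 : f = e.symm
    · subst h1
      simp [sub_mul]
      exact Or.inl rfl
    · by_cases h2 : f.snd = e.fst
      · simp [h1, h2]
        left
        rw [h2]
      · simp [h1, h2]
  simp only [Matrix.mulVec, dotProduct, h]
  rw [Finset.sum_sub_distrib, Finset.mul_sum, Finset.sum_filter]
  simp

/-- averaging operator -/
noncomputable def T : (V → ℂ) →ₗ[ℂ] (V → ℂ) where
  toFun g u := (1 / (G.degree u : ℂ)) * ∑ f : G.Dart with f.snd = u, g f.fst
  map_add' g h := by
    funext u
    simp [Finset.sum_add_distrib, mul_add]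
  map_smul' c g := by
    funext u
    simp only [Pi.smul_apply, smul_eq_mul, ← Finset.mul_sum, RingHom.id_apply]
    ring

lemma T_apply (g : V → ℂ) (u : V) :
    T G g u = (1 / (G.degree u : ℂ)) * ∑ f : G.Dart with f.snd = u, g f.fst := rfl

lemma deg_fst_ne (e : G.Dart) : (G.degree e.fst : ℂ) ≠ 0 := by
  have : 0 < G.degree e.fst := (G.degree_pos_iff_exists_adj _).2 ⟨_, e.adj⟩
  exact_mod_cast this.ne'

lemma step (p q : V → ℂ) :
    groverMatrix G *ᵥ (fun e => p e.fst + q e.snd) =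
      fun e => (2 * T G p e.fst + q e.fst) - p e.snd := by
  funext e
  rw [mulVec_grover, T_apply, Finset.sum_add_distrib]
  have h : ∑ f : G.Dart with f.snd = e.fst, q f.snd = (G.degree e.fst : ℂ) * q e.fst := by
    rw [Finset.sum_congr rfl (g := fun _ => q e.fst)]
    · rw [Finset.sum_const, card_snd_fiber, nsmul_eq_mul]
    · intro f hf
      rw [(Finset.mem_filter.1 hf).2]
  rw [h]
  have := deg_fst_ne G e
  simp
  field_simp
  ring

lemma step' (p q p' q' : V → ℂ) (h1 : p' = (2 : ℂ) • T G p + q) (h2 : q' = -p) :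
    groverMatrix G *ᵥ (fun e => p e.fst + q e.snd) = fun e => p' e.fst + q' e.snd := by
  rw [step]
  subst h1 h2
  funext e
  simp
  ring

lemma five (h5 : groverMatrix G ^ 5 = 1) (g : V → ℂ) (e : G.Dart) :
    ((16 : ℂ) • T G (T G (T G (T G g))) - (12 : ℂ) • T G (T G g) + g) e.fst =
    ((8 : ℂ) • T G (T G (T G g)) - (4 : ℂ) • T G g + g) e.snd := by
  have h : groverMatrix G ^ 5 *ᵥ (fun e => (0 : V → ℂ) e.fst + g e.snd) =
      fun e : G.Dart => (0 : V → ℂ) e.fst + g e.snd := by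
    rw [h5, Matrix.one_mulVec]
  simp only [pow_succ', pow_zero, mul_one, ← Matrix.mulVec_mulVec] at h
  rw [step' G 0 g g 0 (by simp) (by simp),
    step' G g 0 ((2 : ℂ) • T G g) (-g) (by simp) rfl,
    step' G _ _ ((4 : ℂ) • T G (T G g) - g) (-((2 : ℂ) • T G g))
      (by simp only [map_smul, smul_smul]; norm_num; abel) rfl,
    step' G _ _ ((8 : ℂ) • T G (T G (T G g)) - (4 : ℂ) • T G g) (-((4 : ℂ) • T G (T G g) - g))
      (by simp only [map_smul, map_sub]; module) rfl,
    step' G _ _ ((16 : ℂ) • T G (T G (T G (T G g))) - (12 : ℂ) • T G (T G g) + g)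
      (-((8 : ℂ) • T G (T G (T G g)) - (4 : ℂ) • T G g))
      (by simp only [map_smul, map_sub]; module) rfl] at h
  have := congrFun h e
  simp at this ⊢
  linear_combination this

lemma sum_deg_T (g : V → ℂ) (hd : ∀ v, 0 < G.degree v) :
    ∑ v, (G.degree v : ℂ) * T G g v = ∑ v, (G.degree v : ℂ) * g v := by
  have h1 : ∀ v, (G.degree v : ℂ) * T G g v = ∑ f : G.Dart with f.snd = v, g f.fst := by
    intro v
    have : (G.degree v : ℂ) ≠ 0 := by exact_mod_cast (hd v).ne'
    rw [T_apply]
    field_simp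
  have h2 : ∀ v, (G.degree v : ℂ) * g v = ∑ f : G.Dart with f.fst = v, g f.fst := by
    intro v
    rw [Finset.sum_congr rfl (g := fun _ => g v)]
    · rw [Finset.sum_const, G.dart_fst_fiber_card_eq_degree, nsmul_eq_mul]
    · intro f hf
      rw [(Finset.mem_filter.1 hf).2]
  simp only [h1, h2]
  rw [Finset.sum_fiberwise, Finset.sum_fiberwise]

lemma const_of (hG : G.Connected) (h : V → ℂ) (H : ∀ e : G.Dart, h e.fst = h e.snd) (u v : V) :
    h u = h v := by
  obtain ⟨w⟩ := hG.preconnected u v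
  induction w with
  | nil => rfl
  | cons hadj _ ih => exact (H ⟨(_, _), hadj⟩).trans ih

lemma main_rel (hG : G.Connected) (h5 : groverMatrix G ^ 5 = 1) (hd : ∀ v, 0 < G.degree v)
    (g : V → ℂ) (u : V) :
    (∑ v, (G.degree v : ℂ)) * (4 * T G (T G g) u + 2 * T G g u - g u) =
      5 * ∑ v, (G.degree v : ℂ) * g v := by
  set t := T G with ht
  have avg : ∀ p q : V → ℂ, (∀ e : G.Dart, p e.fst = q e.snd) → t p = q := by
    intro p q H
    funext u
    have : (G.degree u : ℂ) ≠ 0 := by exact_mod_cast (hd u).ne'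
    rw [ht, T_apply, Finset.sum_congr rfl (g := fun _ => q u)]
    · rw [Finset.sum_const, card_snd_fiber, nsmul_eq_mul]
      field_simp
    · intro f hf
      rw [H, (Finset.mem_filter.1 hf).2]
  have F := five G h5 g
  rw [← ht] at F
  have F' : ∀ e : G.Dart, ((8 : ℂ) • t (t (t g)) - (4 : ℂ) • t g + g) e.fst =
    ((16 : ℂ) • t (t (t (t g))) - (12 : ℂ) • t (t g) + g) e.snd := by
    intro e
    exact (F e.symm).symm
  have A1 := avg _ _ F
  have A2 := avg _ _ F'
  have C := const_of G hG _ (fun e => show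
    (((16 : ℂ) • t (t (t (t g))) - (12 : ℂ) • t (t g) + g) +
      ((8 : ℂ) • t (t (t g)) - (4 : ℂ) • t g + g)) e.fst = _ by
    rw [Pi.add_apply, F e, F' e, add_comm, ← Pi.add_apply])
  simp only [map_add, map_sub, map_smul] at A1 A2
  -- A2 : 8 T^4 - 4 T^2 + T = 16 T^4 - 12 T^2 + 1
  have A3 := congrArg t A2
  simp only [map_add, map_sub, map_smul] at A3
  have K : (4 : ℂ) • t (t (t g)) - (2 : ℂ) • t (t g) - (3 : ℂ) • t g + g = 0 := by
    funext x
    have a1 := congrFun A1 x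
    have a2 := congrFun A2 x
    have a3 := congrFun A3 x
    simp at a1 a2 a3 ⊢
    linear_combination (-1) * a1 - 2 * a3 + 0 * a2
  have K2 := congrArg t K
  simp only [map_add, map_sub, map_smul, map_zero] at K2
  have R : ∀ v, 4 * t (t g) v + 2 * t g v - g v = 4 * t (t g) u + 2 * t g u - g u := by
    intro v
    have c := C v u
    have k1 := congrFun K v
    have k2 := congrFun K u
    have k3 := congrFun K2 v
    have k4 := congrFun K2 u
    simp at c k1 k2 k3 k4
    linear_combination (1/2) * c - 2 * k3 + 2 * k4 - 2 * k1 + 2 * k2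
  have s1 := sum_deg_T G g hd
  have s2 := sum_deg_T G (T G g) hd
  rw [Finset.sum_mul]
  calc _ = ∑ v, ((G.degree v : ℂ) * (4 * t (t g) v + 2 * t g v - g v)) := by
        apply Finset.sum_congr rfl
        intro v _
        rw [R v]
    _ = 4 * ∑ v, (G.degree v : ℂ) * t (t g) v + 2 * ∑ v, (G.degree v : ℂ) * t g v
        - ∑ v, (G.degree v : ℂ) * g v := by
        simp only [Finset.mul_sum, ← Finset.sum_add_distrib, ← Finset.sum_sub_distrib]
        apply Finset.sum_congr rfl
        intro v _
        ring
    _ = _ := by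
        rw [ht, s2, s1]
        ring

lemma no_leaf (hG : G.Connected) (h5 : groverMatrix G ^ 5 = 1) (hd : ∀ v, 0 < G.degree v)
    (u : V) : G.degree u ≠ 1 := by
  intro hu
  obtain ⟨f0, hf0⟩ := Finset.card_eq_one.1 ((card_snd_fiber G u).trans hu)
  have hf0u : f0.snd = u := by
    have : f0 ∈ (Finset.univ : Finset G.Dart).filter (fun f => f.snd = u) := by simp [hf0]
    simpa using this
  have M := main_rel G hG h5 hd (Pi.single u 1) u
  have T1 : ∀ g, T G g u = g f0.fst := by
    intro g
    rw [T_apply, hf0, hu]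
    simp
  have T2 : T G (Pi.single u 1) f0.fst = 1 / (G.degree f0.fst : ℂ) := by
    rw [T_apply, Finset.sum_eq_single f0.symm]
    · simp [hf0u]
    · intro b hb hne
      rw [Pi.single_eq_of_ne]
      rintro h
      apply hne
      ext
      · simp [h, hf0u]
      · simpa using hb
    · intro h
      simp at h
  rw [T1, T1, T2, Pi.single_eq_same, Pi.single_eq_of_ne (hf0u ▸ f0.adj.ne)] at M
  have E : ∑ v, (G.degree v : ℂ) * (Pi.single u 1 : V → ℂ) v = 1 := by
    rw [Finset.sum_eq_single u]
    · simp [hu]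
    · intro b _ hb
      simp [hb]
    · simp
  have D : ∑ v, (G.degree v : ℂ) = 2 * (G.edgeFinset.card : ℂ) := by
    exact_mod_cast G.sum_degrees_eq_twice_card_edges
  rw [E, D] at M
  have hw := deg_fst_ne G f0
  have hw' := hd f0.fst
  generalize G.degree f0.fst = d at *
  generalize G.edgeFinset.card = m at *
  field_simp at M
  have M' : 2 * (m : ℤ) * (4 - d) = 5 * d := by
    have : ((2 * (m : ℤ) * (4 - d) : ℤ) : ℂ) = ((5 * d : ℤ) : ℂ) := by
      push_cast
      linear_combination M
    exact_mod_cast this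
  have : d < 4 := by
    by_contra hc
    have : (4 : ℤ) - d ≤ 0 := by omega
    nlinarith
  interval_cases d <;> omega

lemma edges_le (h5 : groverMatrix G ^ 5 = 1) : G.edgeFinset.card ≤ Fintype.card V := by
  let L : (G.edgeSet → ℂ) →ₗ[ℂ] (V → ℂ) :=
    { toFun := fun φ v => ∑ f : G.Dart with f.snd = v, φ ⟨f.edge, f.edge_mem⟩
      map_add' := by
        intro a b
        funext v
        simp [Finset.sum_add_distrib]
      map_smul' := by
        intro a b
        funext v
        simp [Finset.mul_sum] }
  have hL : Function.Injective L := by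
    rw [← LinearMap.ker_eq_bot, LinearMap.ker_eq_bot']
    intro φ hφ
    let ψ : G.Dart → ℂ := fun f => φ ⟨f.edge, f.edge_mem⟩
    have hU : groverMatrix G *ᵥ ψ = -ψ := by
      funext e
      rw [mulVec_grover]
      have : ∑ f with f.snd = e.fst, ψ f = 0 := congrFun hφ e.fst
      rw [this]
      simp [ψ]
    have h : groverMatrix G ^ 5 *ᵥ ψ = ψ := by rw [h5, Matrix.one_mulVec]
    simp only [pow_succ', pow_zero, mul_one, ← Matrix.mulVec_mulVec, hU, Matrix.mulVec_neg,
      neg_neg] at h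
    funext ⟨x, hx⟩
    induction x with
    | _ a b =>
      have := congrFun h ⟨(a, b), hx⟩
      have h2 : ψ ⟨(a, b), hx⟩ = 0 := by
        simp only [Pi.neg_apply] at this
        linear_combination (-1/2) * this
      exact h2
  have := LinearMap.finrank_le_finrank_of_injective hL
  rw [Module.finrank_fintype_fun_eq_card, Module.finrank_fintype_fun_eq_card] at this
  rw [SimpleGraph.edgeFinset_card]
  convert this

lemma deg_two (hG : G.Connected) (h5 : groverMatrix G ^ 5 = 1) (hd : ∀ v, 0 < G.degree v)
    (v : V) : G.degree v = 2 := by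
  have h2 : ∀ v ∈ Finset.univ, 2 ≤ G.degree v := by
    intro v _
    have := no_leaf G hG h5 hd v
    have := hd v
    omega
  have hs := G.sum_degrees_eq_twice_card_edges
  have he := edges_le G h5
  have hle : ∑ v : V, 2 ≤ ∑ v, G.degree v := Finset.sum_le_sum h2
  have hc : ∑ v : V, 2 = Fintype.card V * 2 := by simp
  have : ∑ v : V, 2 = ∑ v, G.degree v := by omega
  exact ((Finset.sum_eq_sum_iff_of_le h2).1 this v (Finset.mem_univ v)).symm

/-- In a 2-regular graph, `U` acts as a permutation. -/
lemma exists_prev (hd : ∀ v, G.degree v = 2) (e : G.Dart) :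
    ∃ e' : G.Dart, e'.snd = e.fst ∧ e'.fst ≠ e.snd ∧
      ∀ ψ : G.Dart → ℂ, (groverMatrix G *ᵥ ψ) e = ψ e' := by
  have hc := (card_snd_fiber G e.fst).trans (hd _)
  have hm : e.symm ∈ (Finset.univ : Finset G.Dart).filter (fun f => f.snd = e.fst) := by simp
  have hc' := Finset.card_erase_of_mem hm
  rw [hc] at hc'
  obtain ⟨e', he'⟩ := Finset.card_eq_one.1 hc'
  have hin : e' ∈ ((Finset.univ : Finset G.Dart).filter (fun f => f.snd = e.fst)).erase e.symm := by
    simp [he']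
  simp only [Finset.mem_erase, Finset.mem_filter, Finset.mem_univ, true_and] at hin
  refine ⟨e', hin.2, ?_, ?_⟩
  · intro h
    apply hin.1
    ext
    · simpa using h
    · simpa using hin.2
  · intro ψ
    rw [mulVec_grover, ← Finset.add_sum_erase _ _ hm, he', hd]
    simp

lemma nbr (hd : ∀ v, G.degree v = 2) {a b c : V} (hb : G.Adj a b) (hc : G.Adj a c) (hbc : b ≠ c)
    (x : V) : G.Adj a x ↔ x = b ∨ x = c := by
  have h : ({b, c} : Finset V) = G.neighborFinset a := by
    apply Finset.eq_of_subset_of_card_le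
    · intro y hy
      simp only [Finset.mem_insert, Finset.mem_singleton] at hy
      rcases hy with rfl | rfl <;> simpa
    · rw [G.card_neighborFinset_eq_degree, hd, Finset.card_pair hbc]
  rw [← G.mem_neighborFinset, ← h]
  simp

lemma iso_of (hG : G.Connected) (h5 : groverMatrix G ^ 5 = 1) (hd : ∀ v, G.degree v = 2)
    (e : G.Dart) : Nonempty (G ≃g SimpleGraph.cycleGraph 5) := by
  choose prev h1 h2 h3 using exists_prev G hd
  have h3' : ∀ ψ, groverMatrix G *ᵥ ψ = fun e => ψ (prev e) := fun ψ => funext fun e => h3 e ψ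
  have hp : prev (prev (prev (prev (prev e)))) = e := by
    have h : groverMatrix G ^ 5 *ᵥ (Pi.single e 1) = Pi.single e 1 := by
      rw [h5, Matrix.one_mulVec]
    simp only [pow_succ', pow_zero, mul_one, ← Matrix.mulVec_mulVec, h3'] at h
    have := congrFun h e
    by_contra hne
    simp [Pi.single_apply, hne] at this
  have a1 := h1 e
  have a2 := h1 (prev e)
  have a3 := h1 (prev (prev e))
  have a4 := h1 (prev (prev (prev e)))
  have a5 := h1 (prev (prev (prev (prev e))))
  have b1 := h2 e
  have b2 := h2 (prev e)
  have b3 := h2 (prev (prev e))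
  have b4 := h2 (prev (prev (prev e)))
  have b5 := h2 (prev (prev (prev (prev e))))
  have c1 := (prev e).adj
  have c2 := (prev (prev e)).adj
  have c3 := (prev (prev (prev e))).adj
  have c4 := (prev (prev (prev (prev e)))).adj
  have c5 := e.adj
  rw [hp] at a5 b5
  rw [a1] at b2 c1
  rw [a2] at b3 c2
  rw [a3] at b4 c3
  rw [a4] at b5 c4
  rw [a5] at b1 c5
  generalize e.fst = x0 at *
  generalize (prev e).fst = x1 at *
  generalize (prev (prev e)).fst = x2 at *
  generalize (prev (prev (prev e))).fst = x3 at *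
  generalize (prev (prev (prev (prev e)))).fst = x4 at *
  have n0 := nbr G hd c1.symm c5 b1
  have n1 := nbr G hd c2.symm c1 b2
  have n2 := nbr G hd c3.symm c2 b3
  have n3 := nbr G hd c4.symm c3 b4
  have n4 := nbr G hd c5.symm c4 b5
  have all : ∀ v, v = x0 ∨ v = x1 ∨ v = x2 ∨ v = x3 ∨ v = x4 := by
    intro v
    have key : ∀ u w : V, G.Walk u w → (u = x0 ∨ u = x1 ∨ u = x2 ∨ u = x3 ∨ u = x4) →
        (w = x0 ∨ w = x1 ∨ w = x2 ∨ w = x3 ∨ w = x4) := by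
      intro u w p
      induction p with
      | nil => exact id
      | cons hadj _ ih =>
        intro hu
        apply ih
        rcases hu with rfl | rfl | rfl | rfl | rfl
        · rw [n0] at hadj; tauto
        · rw [n1] at hadj; tauto
        · rw [n2] at hadj; tauto
        · rw [n3] at hadj; tauto
        · rw [n4] at hadj; tauto
    obtain ⟨p⟩ := hG.preconnected x0 v
    exact key _ _ p (Or.inl rfl)
  have d1 := c1.ne
  have d2 := c2.ne
  have d3 := c3.ne
  have d4 := c4.ne
  have d5 := c5.ne
  let F : Fin 5 → V := ![x0, x1, x2, x3, x4]
  have hF : Function.Bijective F := by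
    constructor
    · intro i j hij
      fin_cases i <;> fin_cases j <;> simp [F] at hij ⊢ <;> first | exact absurd hij ‹_› | exact absurd hij.symm ‹_›
    · intro v
      rcases all v with rfl | rfl | rfl | rfl | rfl
      exacts [⟨0, rfl⟩, ⟨1, rfl⟩, ⟨2, rfl⟩, ⟨3, rfl⟩, ⟨4, rfl⟩]
  refine ⟨SimpleGraph.Iso.symm ⟨Equiv.ofBijective F hF, ?_⟩⟩
  intro i j
  have adj : ∀ i j : Fin 5, (SimpleGraph.cycleGraph 5).Adj i j ↔ j = i + 1 ∨ j = i + 4 := by decide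
  rw [adj]
  change G.Adj (F i) (F j) ↔ _
  have hFi : ∀ i, G.Adj (F i) (F j) ↔ F j = F (i + 1) ∨ F j = F (i + 4) := by
    intro i
    fin_cases i
    exacts [n0 _, n1 _, n2 _, n3 _, n4 _]
  rw [hFi, hF.1.eq_iff, hF.1.eq_iff]

/-- The iso of darts induced by a graph iso. -/
def dartEquiv {W : Type*} {G : SimpleGraph V} {H : SimpleGraph W} (φ : G ≃g H) :
    G.Dart ≃ H.Dart where
  toFun e := ⟨(φ e.fst, φ e.snd), φ.map_rel_iff.2 e.adj⟩
  invFun e := ⟨(φ.symm e.fst, φ.symm e.snd), φ.symm.map_rel_iff.2 e.adj⟩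
  left_inv e := by ext <;> simp
  right_inv e := by ext <;> simp

lemma periodic_of_iso {W : Type*} [Fintype W] [DecidableEq W] (H : SimpleGraph W)
    [DecidableRel H.Adj] (φ : G ≃g H) (k : ℕ) (h : InducesPeriodicGroverWalk H k) :
    InducesPeriodicGroverWalk G k := by
  have hU : groverMatrix H = Matrix.reindexAlgEquiv ℂ ℂ (dartEquiv φ) (groverMatrix G) := by
    ext e f
    obtain ⟨e, rfl⟩ := (dartEquiv φ).surjective e
    obtain ⟨f, rfl⟩ := (dartEquiv φ).surjective f
    simp only [Matrix.reindexAlgEquiv_apply, Matrix.reindex_apply, Matrix.submatrix_apply,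
      Equiv.symm_apply_apply]
    unfold groverMatrix
    have e1 : (dartEquiv φ e).symm = dartEquiv φ e.symm := rfl
    have e2 : ((dartEquiv φ f).snd = (dartEquiv φ e).fst) ↔ f.snd = e.fst := φ.injective.eq_iff
    have e3 : H.degree (dartEquiv φ f).snd = G.degree f.snd := φ.degree_eq f.snd
    rw [e1, e3]
    simp only [e2, (dartEquiv φ).injective.eq_iff]
  have hk : ∀ j, groverMatrix H ^ j = 1 ↔ groverMatrix G ^ j = 1 := by
    intro j
    rw [hU, ← map_pow]
    exact map_eq_one_iff _ (Matrix.reindexAlgEquiv ℂ ℂ (dartEquiv φ)).injective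
  unfold InducesPeriodicGroverWalk at *
  simpa only [hk, ne_eq] using h

/-- previous dart on the 5-cycle -/
def prev5 (e : (SimpleGraph.cycleGraph 5).Dart) : (SimpleGraph.cycleGraph 5).Dart :=
  ⟨(2 * e.fst - e.snd, e.fst), by
    have : ∀ i j : Fin 5, (SimpleGraph.cycleGraph 5).Adj i j →
      (SimpleGraph.cycleGraph 5).Adj (2 * i - j) i := by decide
    exact this _ _ e.adj⟩

lemma cycle_mulVec (ψ : (SimpleGraph.cycleGraph 5).Dart → ℂ) :
    groverMatrix (SimpleGraph.cycleGraph 5) *ᵥ ψ = fun e => ψ (prev5 e) := by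
  funext e
  have hd : ∀ v, (SimpleGraph.cycleGraph 5).degree v = 2 := by decide
  obtain ⟨e', h1, h2, h3⟩ := exists_prev _ hd e
  rw [h3]
  congr 1
  have key : ∀ a b c : Fin 5, (SimpleGraph.cycleGraph 5).Adj a b →
    (SimpleGraph.cycleGraph 5).Adj c a → c ≠ b → c = 2 * a - b := by decide
  ext1
  refine Prod.ext (key _ _ _ e.adj (h1 ▸ e'.adj) h2) h1

lemma cycle_periodic : InducesPeriodicGroverWalk (SimpleGraph.cycleGraph 5) 5 := by
  have hpow : ∀ (j : ℕ) (ψ : (SimpleGraph.cycleGraph 5).Dart → ℂ),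
      groverMatrix (SimpleGraph.cycleGraph 5) ^ j *ᵥ ψ = fun e => ψ (prev5^[j] e) := by
    intro j
    induction j with
    | zero => intro ψ; simp
    | succ n ih =>
      intro ψ
      rw [pow_succ, ← Matrix.mulVec_mulVec, cycle_mulVec, ih]
      funext e
      rw [Function.iterate_succ_apply']
  constructor
  · apply Matrix.toLin'.injective
    apply LinearMap.ext
    intro ψ
    rw [Matrix.toLin'_apply, Matrix.toLin'_apply, hpow, Matrix.one_mulVec]
    funext e
    congr 1
    have key : ∀ a b : Fin 5, (2 * (2 * (2 * (2 * (2 * a - b) - a) - (2 * a - b)) -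
       (2 * (2 * a - b) - a)) - (2 * (2 * (2 * a - b) - a) - (2 * a - b))) = a ∧
       (2 * (2 * (2 * (2 * a - b) - a) - (2 * a - b)) - (2 * (2 * a - b) - a)) = b := by decide
    ext1
    exact Prod.ext (key e.fst e.snd).1 (key e.fst e.snd).2
  · intro j hj1 hj5 h
    let e0 : (SimpleGraph.cycleGraph 5).Dart := ⟨(0, 1), by decide⟩
    have hp : prev5^[j] e0 = e0 := by
      have h' := hpow j (Pi.single e0 1)
      rw [h, Matrix.one_mulVec] at h'
      have := congrFun h' e0
      by_contra hne
      simp [Pi.single_apply, hne] at this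
    interval_cases j <;> revert hp <;> decide

end GroverAux

/-- **part of Theorem 3.2.** A finite simple connected graph `G` induces a
`5`-periodic Grover walk iff `G` is isomorphic to the cycle graph `C₅`. -/
theorem five_periodic_iff_cycleGraph_five {V : Type*} [Fintype V] [DecidableEq V]
    (G : SimpleGraph V) [DecidableRel G.Adj] (hG : G.Connected) :
    InducesPeriodicGroverWalk G 5 ↔ Nonempty (G ≃g SimpleGraph.cycleGraph 5) := by
  constructor
  · rintro ⟨h5, hne⟩
    have hdart : Nonempty G.Dart := by
      by_contra hc
      rw [not_nonempty_iff] at hc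
      exact hne 1 le_rfl (by norm_num) (Subsingleton.elim _ _)
    obtain ⟨e⟩ := hdart
    have : Nontrivial V := ⟨⟨e.fst, e.snd, e.adj.ne⟩⟩
    have hd : ∀ v, 0 < G.degree v := fun v => hG.preconnected.degree_pos_of_nontrivial v
    exact GroverAux.iso_of G hG h5 (GroverAux.deg_two G hG h5 hd) e
  · rintro ⟨φ⟩
    exact GroverAux.periodic_of_iso G _ φ 5 GroverAux.cycle_periodic
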